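/- Let g, N be nonzero complex numbers and α, β : ℕ → ℂ sequences. Define, for n ≥ 1, p_n := α_n, q_n := (β_{n−1} − 1/(2g))/(√2·i), a(n) := n/(√2·i·g·N), and set t := 1/(4g^2). Then α, β satisfy the coupled system n/N = α_n·(1 − g(β_n + β_{n−1})) and β_n = g(α_{n+1} + β_n^2 + α_n) for all n ≥ 1 if and only if p, q satisfy the discrete Painlevé II system p_n(q_n + q_{n+1}) = −a(n) and p_{n+1} + p_n = 2q_{n+1}^2 + t for all n ≥ 1. -/

import Mathlib

open Complex

/-- The coupled system for the recursive coefficients of the cubic matrix model is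
equivalent, via the change of variables `p n = α n`, `q n = (β (n-1) - 1/(2g))/(√2·i)`,
`a n = n/(√2·i·g·N)`, `t = 1/(4g²)`, to the discrete Painlevé II system. -/
theorem cubic_dPII_change_of_variables (g N : ℂ) (hg : g ≠ 0) (hN : N ≠ 0)
    (α β : ℕ → ℂ) (p q : ℕ → ℂ) (a : ℕ → ℂ) (t : ℂ)
    (hp : ∀ n, 1 ≤ n → p n = α n)
    (hq : ∀ n, 1 ≤ n → q n = (β (n - 1) - 1 / (2 * g)) / ((Real.sqrt 2 : ℂ) * I))
    (ha : ∀ n, 1 ≤ n → a n = (n : ℂ) / ((Real.sqrt 2 : ℂ) * I * g * N))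
    (ht : t = 1 / (4 * g ^ 2)) :
    (∀ n : ℕ, 1 ≤ n →
        (n : ℂ) / N = α n * (1 - g * (β n + β (n - 1))) ∧
        β n = g * (α (n + 1) + (β n) ^ 2 + α n)) ↔
    (∀ n : ℕ, 1 ≤ n →
        p n * (q n + q (n + 1)) = -a n ∧
        p (n + 1) + p n = 2 * (q (n + 1)) ^ 2 + t) := by
  have hs : ((Real.sqrt 2 : ℂ) * I) ^ 2 = -2 := by
    rw [mul_pow, I_sq, ← ofReal_pow, Real.sq_sqrt zero_le_two]
    norm_num
  generalize (Real.sqrt 2 : ℂ) * I = s at hq ha hs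
  have hs0 : s ≠ 0 := by
    rintro rfl
    norm_num at hs
  refine forall₂_congr fun n hn => ?_
  rw [hp n hn, hp (n + 1) (by omega), hq n hn, hq (n + 1) (by omega), ha n hn, ht,
    Nat.add_sub_cancel, div_pow, hs]
  have first_difference :
      α n * ((β (n - 1) - 1 / (2 * g)) / s + (β n - 1 / (2 * g)) / s) - -(n / (s * g * N)) =
        (n / N - α n * (1 - g * (β n + β (n - 1)))) / (s * g) := by
    field_simp
    ring
  have second_difference :
      α (n + 1) + α n - (2 * ((β n - 1 / (2 * g)) ^ 2 / -2) + 1 / (4 * g ^ 2)) =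
        -(β n - g * (α (n + 1) + β n ^ 2 + α n)) / g := by
    field_simp
    ring
  refine and_congr ?_ ?_
  · rw [← sub_eq_zero, ← sub_eq_zero (b := -_), first_difference, div_eq_zero_iff,
      or_iff_left (mul_ne_zero hs0 hg)]
  · rw [← sub_eq_zero, ← sub_eq_zero (a := α (n + 1) + α n), second_difference,
      div_eq_zero_iff, or_iff_left hg, neg_eq_zero]
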